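/- Let G be a torsion-free group which is not free and is generated by two elements. Suppose G acts simplicially, without inversions, and 2-acylindrically on a simplicial tree T having at least one edge, in such a way that there are exactly two G-orbits of vertices, exactly two G-orbits of unordered edges, and the two endpoints of every edge lie in different vertex orbits. Then there exist a generating pair (g,h) of G, a vertex v, vertices x and y adjacent to v such that the edges {v,x} and {v,y} lie in different G-orbits, and integers n, m ≥ 1 with g^n ≠ 1 and g^m ≠ 1, such that g·v = v, g^n·x = x, g^m·y = y, and either h·x = y or h·y = x. -/

import Mathlib

/-- Two vertices are in the same orbit of the `G`-action. -/
def SameVertexOrbit (G : Type*) {V : Type*} [Group G] [MulAction G V] (u v : V) : Prop :=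
  ∃ g : G, g • u = v

/-- Two unordered edges, given by their endpoints, are in the same orbit of the `G`-action. -/
def SameEdgeOrbit (G : Type*) {V : Type*} [Group G] [MulAction G V] (u w x y : V) : Prop :=
  ∃ g : G, (g • u = x ∧ g • w = y) ∨ (g • u = y ∧ g • w = x)

namespace SimpleGraph.IsTree

variable {V : Type*} {T : SimpleGraph V}

lemma eq_of_adj_of_dist_eq_add_one (hT : T.IsTree) {r u u' w : V} (hu : T.Adj u w)
    (hu' : T.Adj u' w) (h : T.dist r w = T.dist r u + 1) (h' : T.dist r w = T.dist r u' + 1) :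
    u = u' := by
  obtain ⟨p, hp⟩ := hT.connected.exists_walk_length_eq_dist r u
  obtain ⟨q, hq⟩ := hT.connected.exists_walk_length_eq_dist r u'
  have hp' : (p.concat hu).IsPath := Walk.isPath_of_length_eq_dist _ (by simp [hp, h])
  have hq' : (q.concat hu').IsPath := Walk.isPath_of_length_eq_dist _ (by simp [hq, h'])
  have := congrArg Walk.penultimate ((hT.existsUnique_path r w).unique hp' hq')
  simpa using this

lemma exists_adj_dist_add_one_eq (hT : T.IsTree) {u v : V} (hne : u ≠ v) :
    ∃ w, T.Adj u w ∧ T.dist w v + 1 = T.dist u v := by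
  obtain ⟨p, hp⟩ := hT.connected.exists_walk_length_eq_dist u v
  cases p with
  | nil => exact absurd rfl hne
  | @cons _ w _ h q =>
    refine ⟨w, h, ?_⟩
    have h1 := T.dist_le q
    have h2 := hT.connected.dist_triangle (u := u) (v := w) (w := v)
    rw [dist_eq_one_iff_adj.mpr h] at h2
    simp only [Walk.length_cons] at hp
    omega

lemma dist_eq_zero (hT : T.IsTree) {u v : V} (h : T.dist u v = 0) : u = v :=
  hT.connected.dist_eq_zero_iff.mp h

/-- An edge of a tree separates the vertices that are closer to one end from those closer to the
other. -/
lemma dist_eq_add_of_adj (hT : T.IsTree) {x x' y z : V} (hadj : T.Adj x x')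
    (hy : T.dist y x = T.dist y x' + 1) (hz : T.dist z x' = T.dist z x + 1) :
    T.dist y z = T.dist y x + T.dist x z := by
  induction hn : T.dist z x generalizing z with
  | zero => simp [hT.dist_eq_zero hn]
  | succ n ih =>
    have hne : z ≠ x := by rintro rfl; simp at hn
    obtain ⟨w, hzw, hw⟩ := hT.exists_adj_dist_add_one_eq hne
    have hwx' := hT.dist_eq_dist_add_one_of_adj x' hzw
    have c1 := T.dist_comm (u := x') (v := z)
    have c2 := T.dist_comm (u := x') (v := w)
    have c3 := T.dist_comm (u := x) (v := z)
    have c4 := T.dist_comm (u := x) (v := w)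
    have t1 := hT.connected.dist_triangle (u := w) (v := x) (w := x')
    rw [dist_eq_one_iff_adj.mpr hadj] at t1
    have hyw := ih (z := w) (by omega) (by omega)
    rcases hT.dist_eq_dist_add_one_of_adj y hzw with h | h
    · omega
    exfalso
    by_cases hwx : w = x
    · subst hwx
      have := hT.eq_of_adj_of_dist_eq_add_one hzw hadj.symm h hy
      subst this
      simp at hz
    · obtain ⟨w', hww', hw'⟩ := hT.exists_adj_dist_add_one_eq hwx
      have t2 := hT.connected.dist_triangle (u := y) (v := x) (w := w')
      have c5 := T.dist_comm (u := x) (v := w')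
      have t3 := hT.dist_eq_dist_add_one_of_adj y hww'
      have := hT.eq_of_adj_of_dist_eq_add_one hzw hww'.symm h (by omega)
      subst this
      omega

/-- Trees are `0`-hyperbolic. -/
lemma dist_add_dist_le_max (hT : T.IsTree) (x y z w : V) :
    T.dist x y + T.dist z w ≤ max (T.dist x z + T.dist y w) (T.dist x w + T.dist y z) := by
  induction hn : T.dist x y generalizing x with
  | zero =>
    obtain rfl := hT.dist_eq_zero hn
    have := hT.connected.dist_triangle (u := z) (v := x) (w := w)
    have := T.dist_comm (u := x) (v := z)
    omega
  | succ n ih =>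
    have hne : x ≠ y := by rintro rfl; simp at hn
    obtain ⟨x', hxx', hx'⟩ := hT.exists_adj_dist_add_one_eq hne
    have hx := ih x' (by omega)
    have c1 := T.dist_comm (u := x) (v := y)
    have c2 := T.dist_comm (u := x') (v := y)
    have c3 := T.dist_comm (u := x) (v := z)
    have c4 := T.dist_comm (u := x') (v := z)
    have c5 := T.dist_comm (u := x) (v := w)
    have c6 := T.dist_comm (u := x') (v := w)
    have t := hT.connected.dist_triangle (u := z) (v := x) (w := w)
    rcases hT.dist_eq_dist_add_one_of_adj z hxx' with h1 | h1
    · rcases hT.dist_eq_dist_add_one_of_adj w hxx' with h2 | h2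
      · omega
      · have := hT.dist_eq_add_of_adj hxx' (y := y) (z := w) (by omega) h2
        omega
    · have := hT.dist_eq_add_of_adj hxx' (y := y) (z := z) (by omega) h1
      omega

lemma eq_of_dist_eq_of_between (hT : T.IsTree) {a b m m' : V}
    (hm : T.dist a m + T.dist m b = T.dist a b) (hm' : T.dist a m' + T.dist m' b = T.dist a b)
    (h : T.dist a m = T.dist a m') : m = m' := by
  apply hT.dist_eq_zero
  have := hT.dist_add_dist_le_max a b m m'
  have := T.dist_comm (u := m) (v := b)
  have := T.dist_comm (u := m') (v := b)
  omega

end SimpleGraph.IsTree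

/-- A bi-infinite geodesic. -/
def SimpleGraph.IsLine {V : Type*} (T : SimpleGraph V) (γ : ℤ → V) : Prop :=
  ∀ i j, T.dist (γ i) (γ j) = (i - j).natAbs

/-- `γ n` is the nearest point to `z` on the line `γ`. -/
def SimpleGraph.IsProj {V : Type*} (T : SimpleGraph V) (γ : ℤ → V) (z : V) (n : ℤ) : Prop :=
  ∀ k, T.dist z (γ k) = T.dist z (γ n) + (k - n).natAbs

namespace SimpleGraph

variable {V : Type*} {T : SimpleGraph V} {γ : ℤ → V}

lemma IsLine.neg (hγ : T.IsLine γ) : T.IsLine fun n ↦ γ (-n) := by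
  intro i j
  rw [hγ]
  omega

lemma IsLine.adj (hγ : T.IsLine γ) (n : ℤ) : T.Adj (γ n) (γ (n + 1)) := by
  rw [← dist_eq_one_iff_adj, hγ]
  omega

lemma IsLine.isProj (hγ : T.IsLine γ) (n : ℤ) : T.IsProj γ (γ n) n := by
  intro k
  rw [hγ, hγ]
  omega

lemma IsProj.neg {z : V} {n : ℤ} (h : T.IsProj γ z n) : T.IsProj (fun n ↦ γ (-n)) z (-n) := by
  intro k
  have := h (-k)
  simp only [neg_neg]
  omega

lemma IsProj.unique {z : V} {m n : ℤ} (hm : T.IsProj γ z m) (hn : T.IsProj γ z n) : m = n := by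
  have := hm n
  have := hn m
  omega

namespace IsTree

lemma isLine_of_adj_of_ne (hT : T.IsTree) (hadj : ∀ n, T.Adj (γ n) (γ (n + 1)))
    (hne : ∀ n, γ n ≠ γ (n + 2)) : T.IsLine γ := by
  have key (i : ℤ) (k : ℕ) : T.dist (γ i) (γ (i + k)) = k ∧
      T.dist (γ i) (γ (i + k + 1)) = k + 1 := by
    induction k with
    | zero => simpa using hadj i
    | succ k ih =>
      have e : i + ((k + 1 : ℕ) : ℤ) = i + k + 1 := by push_cast; ring
      rw [e]
      refine ⟨ih.2, ?_⟩
      rcases hT.dist_eq_dist_add_one_of_adj (γ i) (hadj (i + k + 1)) with h | h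
      · refine absurd (hT.eq_of_adj_of_dist_eq_add_one (hadj (i + k))
          (hadj (i + k + 1)).symm (r := γ i) (by omega) h) ?_
        rw [show i + (k : ℤ) + 1 + 1 = i + k + 2 by ring]
        exact hne _
      · omega
  intro i j
  rcases le_total i j with h | h
  · have := (key i (j - i).natAbs).1
    rw [show i + ((j - i).natAbs : ℤ) = j by omega] at this
    omega
  · have := (key j (i - j).natAbs).1
    rw [show j + ((i - j).natAbs : ℤ) = i by omega] at this
    rw [T.dist_comm]
    omega

lemma exists_isProj (hT : T.IsTree) (hγ : T.IsLine γ) (z : V) : ∃ n, T.IsProj γ z n := by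
  obtain ⟨n, hn⟩ : ∃ n, ∀ k, T.dist z (γ n) ≤ T.dist z (γ k) :=
    ⟨_, fun k ↦ Function.argmin_le (fun k ↦ T.dist z (γ k)) k⟩
  refine ⟨n, fun k ↦ ?_⟩
  have t := hT.connected.dist_triangle (u := z) (v := γ n) (w := γ k)
  have h5 := hγ n k
  rcases lt_trichotomy k n with h | rfl | h
  · have h1 := hT.dist_eq_dist_add_one_of_adj z (hγ.adj (n - 1))
    rw [sub_add_cancel] at h1
    have h2 := hT.dist_add_dist_le_max z (γ (n - 1)) (γ n) (γ k)
    have h3 := hγ (n - 1) k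
    have h4 := hγ (n - 1) n
    have h6 := hn (n - 1)
    omega
  · simp
  · have h1 := hT.dist_eq_dist_add_one_of_adj z (hγ.adj n)
    have h2 := hT.dist_add_dist_le_max z (γ (n + 1)) (γ n) (γ k)
    have h3 := hγ (n + 1) k
    have h4 := hγ (n + 1) n
    have h6 := hn (n + 1)
    omega

lemma dist_eq_of_isProj_ne (hT : T.IsTree) (hγ : T.IsLine γ) {z w : V} {i j : ℤ}
    (hz : T.IsProj γ z i) (hw : T.IsProj γ w j) (hij : i ≠ j) :
    T.dist z w = T.dist z (γ i) + (i - j).natAbs + T.dist w (γ j) := by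
  have h1 := hT.dist_add_dist_le_max z (γ j) w (γ i)
  have h2 := hT.connected.dist_triangle (u := z) (v := γ i) (w := w)
  have h3 := hz j
  have h4 := hw i
  have h5 := hγ i j
  have c1 := T.dist_comm (u := γ j) (v := w)
  have c2 := T.dist_comm (u := γ i) (v := w)
  have c3 := T.dist_comm (u := γ i) (v := γ j)
  omega

lemma isProj_of_between (hT : T.IsTree) (hγ : T.IsLine γ) {z u : V} {n : ℤ} (hz : T.IsProj γ z n)
    (hu : T.dist z u + T.dist u (γ n) = T.dist z (γ n)) : T.IsProj γ u n := by
  intro k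
  have h1 := hT.connected.dist_triangle (u := z) (v := u) (w := γ k)
  have h2 := hT.connected.dist_triangle (u := u) (v := γ n) (w := γ k)
  have h3 := hz k
  have h4 := hγ n k
  omega

end IsTree
end SimpleGraph

section Action

variable {G V : Type*} [Group G] [MulAction G V] {T : SimpleGraph V}

lemma dist_smul_smul_of_adj (hT : T.Connected)
    (hsimp : ∀ (g : G) (u v : V), T.Adj u v → T.Adj (g • u) (g • v)) (g : G) (u v : V) :
    T.dist (g • u) (g • v) = T.dist u v := by
  have key (g : G) (u v : V) : T.dist (g • u) (g • v) ≤ T.dist u v := by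
    obtain ⟨p, hp⟩ := hT.exists_walk_length_eq_dist u v
    let f : T →g T := ⟨fun x ↦ g • x, fun h ↦ hsimp g _ _ h⟩
    have := T.dist_le (p.map f)
    rw [SimpleGraph.Walk.length_map, hp] at this
    exact this
  refine le_antisymm (key g u v) ?_
  simpa using key g⁻¹ (g • u) (g • v)

/-- `γ` is an axis of `h`, along which `h` translates by `ℓ`. -/
structure IsAxis (T : SimpleGraph V) (h : G) (ℓ : ℕ) (γ : ℤ → V) : Prop where
  isLine : T.IsLine γ
  smul : ∀ n, h • γ n = γ (n + ℓ)

lemma IsAxis.zpow_smul {h : G} {ℓ : ℕ} {γ : ℤ → V} (hγ : IsAxis T h ℓ γ) (k n : ℤ) :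
    h ^ k • γ n = γ (n + k * ℓ) := by
  induction k generalizing n with
  | zero => simp
  | succ k ih => rw [zpow_add_one, mul_smul, hγ.smul, ih]; congr 1; ring
  | pred k ih =>
    rw [zpow_sub_one, mul_smul, show h⁻¹ • γ n = γ (n - ℓ) by
      rw [inv_smul_eq_iff, hγ.smul]; simp, ih]
    congr 1; ring

lemma IsAxis.inv_neg {h : G} {ℓ : ℕ} {γ : ℤ → V} (hγ : IsAxis T h ℓ γ) :
    IsAxis T h⁻¹ ℓ fun n ↦ γ (-n) where
  isLine := hγ.isLine.neg
  smul n := by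
    rw [inv_smul_eq_iff, hγ.smul]
    congr 1; ring

lemma IsAxis.isProj_zpow_smul (hiso : ∀ (g : G) (u v : V), T.dist (g • u) (g • v) = T.dist u v)
    {h : G} {ℓ : ℕ} {γ : ℤ → V} (hγ : IsAxis T h ℓ γ) {z : V} {n : ℤ} (hz : T.IsProj γ z n)
    (k : ℤ) : T.IsProj γ (h ^ k • z) (n + k * ℓ) := by
  intro m
  have h1 := hγ.zpow_smul k (m - k * ℓ)
  rw [sub_add_cancel] at h1
  rw [← h1, ← hγ.zpow_smul k n, hiso, hiso, hz]
  omega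

/-- An element that moves no vertex by less than `ℓ > 0` and some vertex by exactly `ℓ` has an
axis. -/
lemma exists_isAxis (hT : T.IsTree)
    (hsimp : ∀ (g : G) (u v : V), T.Adj u v → T.Adj (g • u) (g • v)) {h : G}
    (hninv : ∀ u v : V, T.Adj u v → ¬(h • u = v ∧ h • v = u))
    {ℓ : ℕ} (hℓ : 0 < ℓ) {p : V} (hp : T.dist p (h • p) = ℓ)
    (hmin : ∀ v, ℓ ≤ T.dist v (h • v)) : ∃ γ : ℤ → V, IsAxis T h ℓ γ := by
  obtain ⟨w, hw⟩ := hT.connected.exists_walk_length_eq_dist p (h • p)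
  rw [hp] at hw
  set γ : ℤ → V := fun n ↦ h ^ (n / ℓ) • w.getVert (n % ℓ).toNat with hγ
  have hℓ' : (0 : ℤ) < ℓ := by exact_mod_cast hℓ
  have hshift (n : ℤ) : h • γ n = γ (n + ℓ) := by
    simp only [hγ]
    rw [Int.add_emod_right, Int.add_ediv_of_dvd_right dvd_rfl, Int.ediv_self hℓ'.ne',
      add_comm, zpow_add, zpow_one, mul_smul]
  have hadj (n : ℤ) : T.Adj (γ n) (γ (n + 1)) := by
    have h0 := Int.emod_nonneg n hℓ'.ne'
    have h1 := Int.emod_lt_of_pos n hℓ'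
    have h2 := Int.emod_add_mul_ediv n ℓ
    have hstep := w.adj_getVert_succ (i := (n % ℓ).toNat) (by omega)
    have : γ (n + 1) = h ^ (n / ℓ) • w.getVert ((n % ℓ).toNat + 1) := by
      rcases (show n % ℓ + 1 < ℓ ∨ n % ℓ + 1 = ℓ by omega) with h3 | h3
      · have e : (n + 1) / ℓ = n / ℓ ∧ (n + 1) % ℓ = n % ℓ + 1 := by
          rw [Int.ediv_emod_unique hℓ']
          exact ⟨by linarith, by omega, h3⟩
        simp only [hγ]
        rw [e.1, e.2, show (n % ℓ + 1).toNat = (n % ℓ).toNat + 1 by omega]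
      · have e : (n + 1) / ℓ = n / ℓ + 1 ∧ (n + 1) % ℓ = 0 := by
          rw [Int.ediv_emod_unique hℓ']
          exact ⟨by linarith, le_rfl, hℓ'⟩
        simp only [hγ]
        rw [e.1, e.2, show (n % ℓ).toNat + 1 = w.length by omega, w.getVert_length]
        simp [zpow_add_one, mul_smul]
    rw [this]
    exact hsimp _ _ _ hstep
  have hle (i : ℤ) (k : ℕ) : T.dist (γ i) (γ (i + k)) ≤ k := by
    induction k with
    | zero => simp
    | succ k ih =>
      have h1 := hT.connected.dist_triangle (u := γ i) (v := γ (i + k)) (w := γ (i + k + 1))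
      rw [SimpleGraph.dist_eq_one_iff_adj.mpr (hadj _)] at h1
      push_cast
      rw [← add_assoc]
      omega
  refine ⟨γ, hT.isLine_of_adj_of_ne hadj fun n hn ↦ ?_, hshift⟩
  rcases (show ℓ = 1 ∨ 2 ≤ ℓ by omega) with rfl | h2
  · refine hninv _ _ (hadj n) ⟨by simpa using hshift n, ?_⟩
    rw [hshift, hn]
    congr 1; push_cast; ring
  · have h3 := hmin (γ n)
    rw [hshift] at h3
    have h4 := hle (n + 2) (ℓ - 2)
    rw [show n + 2 + ((ℓ - 2 : ℕ) : ℤ) = n + ℓ by omega, ← hn] at h4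
    omega

end Action

section FreeGroup

variable {G : Type*} [Group G]

lemma closure_pair_eq_top {a b c d : G} (hab : Subgroup.closure {a, b} = ⊤)
    (ha : a ∈ Subgroup.closure {c, d}) (hb : b ∈ Subgroup.closure {c, d}) :
    Subgroup.closure {c, d} = ⊤ := by
  rw [eq_top_iff, ← hab, Subgroup.closure_le]
  rintro x (rfl | rfl)
  exacts [ha, hb]

lemma closure_pair_swap {a b : G} (hab : Subgroup.closure {a, b} = ⊤) :
    Subgroup.closure {b, a} = ⊤ := by
  rwa [Set.pair_comm]

/-- Ping-pong for two elements of a group. -/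
lemma isFreeGroup_of_ping_pong {V : Type*} [MulAction G V] {a b : G}
    (hgen : Subgroup.closure {a, b} = ⊤) (X Y : Set V) (hX : X.Nonempty) (hY : Y.Nonempty)
    (hXY : Disjoint X Y) (ha : ∀ k : ℤ, k ≠ 0 → ∀ z ∈ Y, a ^ k • z ∈ X)
    (hb : ∀ k : ℤ, k ≠ 0 → ∀ z ∈ X, b ^ k • z ∈ Y) : IsFreeGroup G := by
  let f : Bool → FreeGroup Unit →* G := fun i ↦ FreeGroup.lift fun _ ↦ cond i a b
  let Z : Bool → Set V := fun i ↦ cond i X Y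
  have hinj : Function.Injective (Monoid.CoprodI.lift f) := by
    refine Monoid.CoprodI.lift_injective_of_ping_pong f ?_ Z ?_ ?_ ?_
    · right
      refine ⟨true, ?_⟩
      rw [FreeGroup.freeGroupUnitEquivInt.cardinal_eq, Cardinal.mk_denumerable]
      exact Cardinal.natCast_le_aleph0
    · rintro (_ | _) <;> assumption
    · rintro (_ | _) (_ | _) hij
      exacts [absurd rfl hij, hXY.symm, hXY, absurd rfl hij]
    · intro i j hij
      refine FreeGroup.freeGroupUnitEquivInt.forall_congr_left.mpr fun n hn ↦ ?_
      have hn0 : n ≠ 0 := by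
        rintro rfl
        exact hn (by simp [FreeGroup.freeGroupUnitEquivInt])
      rintro _ ⟨z, hz, rfl⟩
      change FreeGroup.lift (fun _ ↦ cond i a b) (FreeGroup.of () ^ n) • z ∈ Z i
      rw [map_zpow, FreeGroup.lift_apply_of]
      rcases i with _ | _ <;> rcases j with _ | _
      exacts [absurd rfl hij, hb n hn0 z hz, ha n hn0 z hz, absurd rfl hij]
  have hsurj : Function.Surjective (Monoid.CoprodI.lift f) := by
    rw [← MonoidHom.range_eq_top, eq_top_iff, ← hgen, Subgroup.closure_le]
    rintro x (rfl | rfl)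
    · exact ⟨Monoid.CoprodI.of (i := true) (FreeGroup.of ()), by simp [f]⟩
    · exact ⟨Monoid.CoprodI.of (i := false) (FreeGroup.of ()), by simp [f]⟩
  exact IsFreeGroup.ofMulEquiv (MulEquiv.ofBijective _ ⟨hinj, hsurj⟩)

lemma isFreeGroup_of_closure_one_pair (htf : ∀ (g : G) (n : ℕ), 1 ≤ n → g ^ n = 1 → g = 1) {h : G}
    (hne : h ≠ 1) (hgen : Subgroup.closure {1, h} = ⊤) : IsFreeGroup G := by
  have hpow (k : ℤ) (hk : h ^ k = 1) : k = 0 := by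
    by_contra hk0
    refine hne (htf h k.natAbs (by omega) ?_)
    rcases Int.natAbs_eq k with e | e <;> rw [e] at hk
    · simpa using hk
    · simpa using hk
  let f : FreeGroup Unit →* G := FreeGroup.lift fun _ ↦ h
  have hinj : Function.Injective f := by
    rw [injective_iff_map_eq_one]
    refine FreeGroup.freeGroupUnitEquivInt.forall_congr_left.mpr fun n hn ↦ ?_
    change FreeGroup.lift (fun _ ↦ h) (FreeGroup.of () ^ n) = 1 at hn
    change FreeGroup.of () ^ n = 1
    rw [map_zpow, FreeGroup.lift_apply_of] at hn
    simp [hpow n hn]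
  have hsurj : Function.Surjective f := by
    rw [← MonoidHom.range_eq_top, eq_top_iff, ← hgen, Subgroup.closure_le]
    rintro x (rfl | rfl)
    · exact one_mem _
    · exact ⟨FreeGroup.of (), by simp [f]⟩
  exact IsFreeGroup.ofMulEquiv (MulEquiv.ofBijective f ⟨hinj, hsurj⟩)

end FreeGroup

lemma Int.natAbs_sub_add_mul_ge (i k : ℤ) (hk : k ≠ 0) (ℓ : ℕ) :
    ℓ ≤ (i - (i + k * ℓ)).natAbs := by
  rw [show i - (i + k * ℓ) = -(k * ℓ) by ring, Int.natAbs_neg, Int.natAbs_mul, Int.natAbs_natCast]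
  exact Nat.le_mul_of_pos_left _ (Int.natAbs_pos.mpr hk)

section Hyperbolic

variable {G V : Type*} [Group G] [MulAction G V] {T : SimpleGraph V} {a b : G} {m n : ℕ}
  {γ δ : ℤ → V}

/-- Two elements translating along axes with short overlap generate a free group. -/
lemma isFreeGroup_of_isAxis (hT : T.IsTree)
    (hiso : ∀ (g : G) (u v : V), T.dist (g • u) (g • v) = T.dist u v)
    (hgen : Subgroup.closure {a, b} = ⊤) (ha : IsAxis T a m γ) (hb : IsAxis T b n δ)
    (hA : ∀ s t i j, T.IsProj γ (δ s) i → T.IsProj γ (δ t) j → (i - j).natAbs < m)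
    (hB : ∀ s t i j, T.IsProj δ (γ s) i → T.IsProj δ (γ t) j → (i - j).natAbs < n) :
    IsFreeGroup G := by
  have hdich (z : V) : (∃ i s, T.IsProj γ z i ∧ T.IsProj γ (δ s) i) ∨
      (∃ j s, T.IsProj δ z j ∧ T.IsProj δ (γ s) j) := by
    obtain ⟨i, hi⟩ := hT.exists_isProj ha.isLine z
    obtain ⟨j, hj⟩ := hT.exists_isProj hb.isLine z
    obtain ⟨i', hi'⟩ := hT.exists_isProj ha.isLine (δ j)
    by_cases hii : i = i'
    · exact .inl ⟨i, j, hi, hii ▸ hi'⟩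
    · refine .inr ⟨j, i, hj, hT.isProj_of_between hb.isLine hj ?_⟩
      have h1 := hT.dist_eq_of_isProj_ne ha.isLine hi hi' hii
      have h2 := hi' i
      have h3 := T.dist_comm (u := δ j) (v := γ i)
      omega
  refine isFreeGroup_of_ping_pong hgen
    {z | ∀ i s, T.IsProj γ z i → ¬ T.IsProj γ (δ s) i}
    {z | ∀ j s, T.IsProj δ z j → ¬ T.IsProj δ (γ s) j} ?_ ?_ ?_ ?_ ?_
  · obtain ⟨i, hi⟩ := hT.exists_isProj ha.isLine (δ 0)
    refine ⟨γ (i + m), fun j s hj hs ↦ ?_⟩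
    obtain rfl := hj.unique (ha.isLine.isProj _)
    have := hA _ _ _ _ hi hs
    omega
  · obtain ⟨i, hi⟩ := hT.exists_isProj hb.isLine (γ 0)
    refine ⟨δ (i + n), fun j s hj hs ↦ ?_⟩
    obtain rfl := hj.unique (hb.isLine.isProj _)
    have := hB _ _ _ _ hi hs
    omega
  · rw [Set.disjoint_left]
    intro z hz hz'
    rcases hdich z with ⟨i, s, h1, h2⟩ | ⟨i, s, h1, h2⟩
    exacts [hz i s h1 h2, hz' i s h1 h2]
  · intro k hk z hz j t hj ht
    rcases hdich z with ⟨i, s, h1, h2⟩ | ⟨i, s, h1, h2⟩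
    · obtain rfl := hj.unique (ha.isProj_zpow_smul hiso h1 k)
      have := hA _ _ _ _ h2 ht
      have := Int.natAbs_sub_add_mul_ge i k hk m
      omega
    · exact hz i s h1 h2
  · intro k hk z hz j t hj ht
    rcases hdich z with ⟨i, s, h1, h2⟩ | ⟨i, s, h1, h2⟩
    · exact hz i s h1 h2
    · obtain rfl := hj.unique (hb.isProj_zpow_smul hiso h1 k)
      have := hB _ _ _ _ h2 ht
      have := Int.natAbs_sub_add_mul_ge i k hk n
      omega

/-- The part of a line `γ` between the projections of two points of a line `δ` is contained in
`δ`. -/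
lemma SimpleGraph.IsLine.overlap (hT : T.IsTree) (hγ : T.IsLine γ) (hδ : T.IsLine δ) {s t i j : ℤ}
    (hs : T.IsProj γ (δ s) i) (ht : T.IsProj γ (δ t) j) (hij : i < j) (hst : s ≤ t) :
    ∃ c, ∀ m, 0 ≤ m → m ≤ j - i → γ (i + m) = δ (c + m) := by
  refine ⟨s + T.dist (δ s) (γ i), fun m h0 h1 ↦ ?_⟩
  have h2 := hT.dist_eq_of_isProj_ne hγ hs ht hij.ne
  have h3 := hs (i + m)
  have h4 := ht (i + m)
  have h5 := T.dist_comm (u := δ t) (v := γ (i + m))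
  have h6 := hδ s t
  have h7 := hδ s (s + T.dist (δ s) (γ i) + m)
  have h8 := hδ (s + T.dist (δ s) (γ i) + m) t
  exact hT.eq_of_dist_eq_of_between (a := δ s) (b := δ t) (by omega) (by omega) (by omega)

lemma IsAxis.dist_smul (ha : IsAxis T a m γ) (i : ℤ) : T.dist (γ i) (a • γ i) = m := by
  rw [ha.smul, ha.isLine]
  omega

/-- If the sum of the translation lengths of a generating pair is minimal, then the overlap of the
two axes is shorter than each translation length. -/
lemma natAbs_sub_lt_of_minimal (hT : T.IsTree)
    (hiso : ∀ (g : G) (u v : V), T.dist (g • u) (g • v) = T.dist u v)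
    (hgen : Subgroup.closure {a, b} = ⊤) (hm : 0 < m) (hn : 0 < n)
    (ha : IsAxis T a m γ) (hb : IsAxis T b n δ)
    (hmin : ∀ a' b' : G, Subgroup.closure {a', b'} = ⊤ → ∀ p q : V,
      m + n ≤ T.dist p (a' • p) + T.dist q (b' • q))
    {s t i j : ℤ} (hs : T.IsProj γ (δ s) i) (ht : T.IsProj γ (δ t) j) : (i - j).natAbs < m := by
  wlog hij : i ≤ j generalizing i j s t
  · have := this ht hs (by omega)
    omega
  wlog hst : s ≤ t generalizing b δ s t
  · refine this (b := b⁻¹) (δ := fun k ↦ δ (-k)) (s := -s) (t := -t) ?_ hb.inv_neg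
      (by simpa using hs) (by simpa using ht) (by omega)
    refine closure_pair_eq_top hgen (Subgroup.subset_closure (by simp)) ?_
    rw [← inv_mem_iff]
    exact Subgroup.subset_closure (by simp)
  by_contra! hlt
  obtain ⟨c, hc⟩ := ha.isLine.overlap hT hb.isLine hs ht (by omega) hst
  have h0 : γ i = δ c := by simpa using hc 0 le_rfl (by omega)
  have h1 : T.dist (γ i) ((a⁻¹ * b) • γ i) = (m - n : ℤ).natAbs := by
    rw [← hiso a, mul_smul, smul_inv_smul, ha.smul, hc m (by omega) (by omega), h0, hb.smul,
      hb.isLine]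
    omega
  rcases le_total m n with hmn | hmn
  · have h2 : Subgroup.closure {a, a⁻¹ * b} = ⊤ := by
      have hA : a ∈ Subgroup.closure {a, a⁻¹ * b} := Subgroup.subset_closure (by simp)
      refine closure_pair_eq_top hgen hA ?_
      have hAB : a⁻¹ * b ∈ Subgroup.closure {a, a⁻¹ * b} := Subgroup.subset_closure (by simp)
      simpa using mul_mem hA hAB
    have h3 := hmin _ _ h2 (γ i) (γ i)
    rw [ha.dist_smul, h1] at h3
    omega
  · have h2 : Subgroup.closure {a⁻¹ * b, b} = ⊤ := by
      have hB : b ∈ Subgroup.closure {a⁻¹ * b, b} := Subgroup.subset_closure (by simp)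
      refine closure_pair_eq_top hgen ?_ hB
      have hAB : a⁻¹ * b ∈ Subgroup.closure {a⁻¹ * b, b} := Subgroup.subset_closure (by simp)
      simpa using mul_mem hB (inv_mem hAB)
    have h3 := hmin _ _ h2 (γ i) (δ c)
    rw [hb.dist_smul, h1] at h3
    omega

/-- A two-generated group acting on a tree such that no member of a generating pair has a fixed
vertex is free. -/
lemma isFreeGroup_of_forall_smul_ne (hT : T.IsTree)
    (hsimp : ∀ (g : G) (u v : V), T.Adj u v → T.Adj (g • u) (g • v))
    (hninv : ∀ (g : G) (u v : V), T.Adj u v → ¬(g • u = v ∧ g • v = u))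
    (h2gen : ∃ a b : G, Subgroup.closure {a, b} = ⊤)
    (hne : ∀ a b : G, Subgroup.closure {a, b} = ⊤ → ∀ v : V, a • v ≠ v) : IsFreeGroup G := by
  have hiso := dist_smul_smul_of_adj hT.connected hsimp
  obtain ⟨r⟩ := hT.connected.nonempty
  obtain ⟨a₀, b₀, h₀⟩ := h2gen
  let S := {x : (G × G) × V × V // Subgroup.closure {x.1.1, x.1.2} = ⊤}
  have : Nonempty S := ⟨⟨((a₀, b₀), r, r), h₀⟩⟩
  let F : S → ℕ := fun x ↦
    T.dist x.1.2.1 (x.1.1.1 • x.1.2.1) + T.dist x.1.2.2 (x.1.1.2 • x.1.2.2)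
  obtain ⟨⟨⟨⟨a, b⟩, p, q⟩, hgen⟩, hmin'⟩ : ∃ x : S, ∀ y, F x ≤ F y :=
    ⟨_, fun y ↦ Function.argmin_le F y⟩
  have hmin (a' b' : G) (h : Subgroup.closure {a', b'} = ⊤) (p' q' : V) :
      T.dist p (a • p) + T.dist q (b • q) ≤ T.dist p' (a' • p') + T.dist q' (b' • q') :=
    hmin' ⟨((a', b'), p', q'), h⟩
  have hm := hT.connected.pos_dist_of_ne (hne a b hgen p).symm
  have hn := hT.connected.pos_dist_of_ne (hne b a (closure_pair_swap hgen) q).symm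
  obtain ⟨γ, hγ⟩ := exists_isAxis hT hsimp (hninv a) hm rfl fun v ↦ by
    have := hmin a b hgen v q
    omega
  obtain ⟨δ, hδ⟩ := exists_isAxis hT hsimp (hninv b) hn rfl fun v ↦ by
    have := hmin a b hgen p v
    omega
  refine isFreeGroup_of_isAxis hT hiso hgen hγ hδ (fun s t i j hs ht ↦ ?_)
    (fun s t i j hs ht ↦ ?_)
  · exact natAbs_sub_lt_of_minimal hT hiso hgen hm hn hγ hδ hmin hs ht
  · refine natAbs_sub_lt_of_minimal hT hiso (closure_pair_swap hgen) hn hm hδ hγ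
      (fun a' b' h p' q' ↦ ?_) hs ht
    have := hmin a' b' h p' q'
    omega

end Hyperbolic

namespace SimpleGraph

variable {V : Type*} {T : SimpleGraph V} {γ : ℤ → V}

lemma IsTree.dist_add_dist_of_isProj (hT : T.IsTree) (hγ : T.IsLine γ) {u z : V} {i j m : ℤ}
    (hu : T.IsProj γ u i) (hz : T.IsProj γ z j) (hij : i < j) (him : i ≤ m) (hmj : m ≤ j) :
    T.dist u (γ m) + T.dist (γ m) z = T.dist u z := by
  have h1 := hT.dist_eq_of_isProj_ne hγ hu hz hij.ne
  have h2 := hu m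
  have h3 := hz m
  have h4 := T.dist_comm (u := z) (v := γ m)
  omega

lemma IsTree.dist_add_dist_of_between (hT : T.IsTree) {u z b c : V}
    (hb : T.dist u b + T.dist b z = T.dist u z) (hc : T.dist u c + T.dist c z = T.dist u z)
    (hbc : T.dist u b ≤ T.dist u c) : T.dist u b + T.dist b c = T.dist u c := by
  have h1 := hT.dist_add_dist_le_max u z b c
  have h2 := T.dist_comm (u := z) (v := b)
  have h3 := T.dist_comm (u := z) (v := c)
  have h4 := hT.connected.dist_triangle (u := u) (v := b) (w := c)
  omega

/-- No point of `F` projects to `γ n`. -/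
def Avoids (T : SimpleGraph V) (γ : ℤ → V) (F : Set V) (n : ℤ) : Prop :=
  ∀ t ∈ F, ¬ T.IsProj γ t n

lemma Avoids.neg {F : Set V} {n : ℤ} (h : T.Avoids γ F n) :
    T.Avoids (fun n ↦ γ (-n)) F (-n) := by
  intro t ht hp
  exact h t ht (by simpa using hp.neg)

lemma Avoids.exists_least {F : Set V} {i j : ℤ} (hi : ¬ T.Avoids γ F i) (h : T.Avoids γ F j)
    (hij : i < j) : ∃ m, i < m ∧ T.Avoids γ F m ∧ ∀ k, i ≤ k → k < m → ¬ T.Avoids γ F k := by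
  classical
  have hex : ∃ n : ℕ, T.Avoids γ F (i + n) :=
    ⟨(j - i).toNat, by rwa [show i + ((j - i).toNat : ℤ) = j by omega]⟩
  have h0 : Nat.find hex ≠ 0 := fun h0 ↦ hi (by simpa [h0] using Nat.find_spec hex)
  refine ⟨i + Nat.find hex, by omega, Nat.find_spec hex, fun k hk hk' hav ↦ ?_⟩
  refine Nat.find_min hex (m := (k - i).toNat) (by omega) ?_
  rwa [show i + ((k - i).toNat : ℤ) = k by omega]

lemma Avoids.exists_greatest {F : Set V} {i j : ℤ} (hi : ¬ T.Avoids γ F i) (h : T.Avoids γ F j)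
    (hij : j < i) : ∃ m, m < i ∧ T.Avoids γ F m ∧ ∀ k, k ≤ i → m < k → ¬ T.Avoids γ F k := by
  have hneg (k : ℤ) (h : T.Avoids (fun n ↦ γ (-n)) F (-k)) : T.Avoids γ F k := by
    simpa using h.neg
  obtain ⟨m, h1, h2, h3⟩ := h.neg.exists_least (i := -i) (fun h ↦ hi (hneg i h)) (by omega)
  refine ⟨-m, by omega, hneg _ (by simpa using h2), fun k hk hk' hav ↦ ?_⟩
  exact h3 (-k) (by omega) (by omega) hav.neg

end SimpleGraph

section Elliptic

variable {G V : Type*} [Group G] [MulAction G V] {T : SimpleGraph V} {g h : G} {ℓ : ℕ}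
  {γ : ℤ → V} {u z : V} {i j j' k : ℤ}

/-- The vertices fixed by some nontrivial power of `g`. -/
def powFixed (V : Type*) [MulAction G V] (g : G) : Set V := {x | ∃ k : ℤ, k ≠ 0 ∧ g ^ k • x = x}

lemma mem_powFixed_of_smul_eq (hu : g • u = u) : u ∈ powFixed V g :=
  ⟨1, one_ne_zero, by simpa⟩

lemma zpow_smul_mem_powFixed (hu : u ∈ powFixed V g) (k : ℤ) : g ^ k • u ∈ powFixed V g := by
  obtain ⟨m, hm, hmu⟩ := hu
  refine ⟨m, hm, ?_⟩
  rw [← mul_smul, ← zpow_add, add_comm, zpow_add, mul_smul, hmu]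

lemma zpow_mul_smul_eq {x : V} (hx : g ^ j • x = x) (k : ℤ) : g ^ (j * k) • x = x := by
  rw [zpow_mul]
  exact zpow_mem (show g ^ j ∈ MulAction.stabilizer G x from hx) k

lemma smul_eq_of_between (hT : T.IsTree)
    (hiso : ∀ (g : G) (u v : V), T.dist (g • u) (g • v) = T.dist u v) {x y m : V}
    (hx : g • x = x) (hy : g • y = y) (hm : T.dist x m + T.dist m y = T.dist x y) : g • m = m := by
  have h1 := hiso g x m
  have h2 := hiso g m y
  rw [hx] at h1
  rw [hy] at h2
  exact hT.eq_of_dist_eq_of_between (a := x) (b := y) (by omega) hm h1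

lemma mem_powFixed_of_between (hT : T.IsTree)
    (hiso : ∀ (g : G) (u v : V), T.dist (g • u) (g • v) = T.dist u v) {x y m : V}
    (hx : x ∈ powFixed V g) (hy : y ∈ powFixed V g) (hm : T.dist x m + T.dist m y = T.dist x y) :
    m ∈ powFixed V g := by
  obtain ⟨k, hk, hkx⟩ := hx
  obtain ⟨l, hl, hly⟩ := hy
  refine ⟨k * l, mul_ne_zero hk hl, smul_eq_of_between hT hiso (zpow_mul_smul_eq hkx l) ?_ hm⟩
  rw [mul_comm]
  exact zpow_mul_smul_eq hly k

lemma zpow_smul_eq_of_smul_eq (hu : g • u = u) (k : ℤ) : g ^ k • u = u :=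
  zpow_mem (show g ∈ MulAction.stabilizer G u from hu) k

/-- If `g` fixes `u`, then a nontrivial power of `g` does not keep a point on the same side of
the line `γ` outside the projection of the vertices fixed by powers of `g`. -/
lemma not_avoids_of_lt_of_lt (hT : T.IsTree)
    (hiso : ∀ (g : G) (u v : V), T.dist (g • u) (g • v) = T.dist u v) (hγ : T.IsLine γ)
    (hu : g • u = u) (hui : T.IsProj γ u i) (hk : k ≠ 0) (hz : T.IsProj γ z j)
    (hz' : T.IsProj γ (g ^ k • z) j') (hij : i < j) (hij' : i < j')
    (hj : T.Avoids γ (powFixed V g) j) : ¬ T.Avoids γ (powFixed V g) j' := by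
  intro hj'
  have hi : ¬ T.Avoids γ (powFixed V g) i := fun h ↦ h u (mem_powFixed_of_smul_eq hu) hui
  obtain ⟨m, him, hm, hlt⟩ := hj.exists_least hi hij
  have hmj : m ≤ j := le_of_not_gt fun h ↦ hlt j hij.le h hj
  have hmj' : m ≤ j' := le_of_not_gt fun h ↦ hlt j' hij'.le h hj'
  have h1 := hT.dist_add_dist_of_isProj hγ hui hz hij him.le hmj
  have h2 := hT.dist_add_dist_of_isProj hγ hui hz' hij' him.le hmj'
  have hgu := zpow_smul_eq_of_smul_eq hu k
  rw [← hiso (g ^ k), ← hiso (g ^ k) (γ m), ← hiso (g ^ k) u z, hgu] at h1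
  have h3 := hiso (g ^ k) u (γ m)
  rw [hgu] at h3
  exact hm (γ m) ⟨k, hk, hT.eq_of_dist_eq_of_between h1 h2 h3⟩ (hγ.isProj m)

lemma mem_powFixed_of_dist_le (hT : T.IsTree)
    (hiso : ∀ (g : G) (u v : V), T.dist (g • u) (g • v) = T.dist u v) (hu : g • u = u) {b c : V}
    (hc : c ∈ powFixed V g) (hcz : T.dist u c + T.dist c z = T.dist u z)
    (hbz : T.dist u b + T.dist b (g ^ k • z) = T.dist u (g ^ k • z))
    (hbc : T.dist u b ≤ T.dist u c) : b ∈ powFixed V g := by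
  have hgu := zpow_smul_eq_of_smul_eq hu k
  rw [← hiso (g ^ k), ← hiso (g ^ k) c, ← hiso (g ^ k) u z, hgu] at hcz
  have h3 := hiso (g ^ k) u c
  rw [hgu] at h3
  exact mem_powFixed_of_between hT hiso (mem_powFixed_of_smul_eq hu) (zpow_smul_mem_powFixed hc k)
    (hT.dist_add_dist_of_between hbz hcz (by omega))

/-- If a power of `g` moves a point from one side of the axis of `h` to the other, outside the
projection of the vertices fixed by powers of `g`, then the translation length of `h` can be
reduced by multiplying with this power. -/
lemma not_avoids_of_lt_of_gt (hT : T.IsTree)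
    (hiso : ∀ (g : G) (u v : V), T.dist (g • u) (g • v) = T.dist u v)
    (hninv : ∀ (g : G) (u v : V), T.Adj u v → ¬(g • u = v ∧ g • v = u))
    (hγ : IsAxis T h ℓ γ) (hu : g • u = u) (hmin : ∀ (k : ℤ) v, ℓ ≤ T.dist v ((h * g ^ k) • v))
    (hF : ∀ s ∈ powFixed V g, ∀ t ∈ powFixed V g, ∀ i j, T.IsProj γ s i → T.IsProj γ t j →
      (i - j).natAbs < ℓ)
    (hui : T.IsProj γ u i) (hz : T.IsProj γ z j)
    (hz' : T.IsProj γ (g ^ k • z) j') (hij : i < j) (hij' : j' < i)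
    (hj : T.Avoids γ (powFixed V g) j) : ¬ T.Avoids γ (powFixed V g) j' := by
  intro hj'
  have hline := hγ.isLine
  have huF := mem_powFixed_of_smul_eq hu
  have hgu := zpow_smul_eq_of_smul_eq hu k
  have hi : ¬ T.Avoids γ (powFixed V g) i := fun h ↦ h u huF hui
  obtain ⟨m, him, hm, hlt⟩ := hj.exists_least hi hij
  obtain ⟨m', him', hm', hgt⟩ := hj'.exists_greatest hi hij'
  have hmj : m ≤ j := le_of_not_gt fun h ↦ hlt j hij.le h hj
  have hmj' : j' ≤ m' := le_of_not_gt fun h ↦ hgt j' hij'.le h hj'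
  have hr (n : ℤ) (h1 : i ≤ n) (h2 : n ≤ m) := hT.dist_add_dist_of_isProj hline hui hz hij h1
    (h2.trans hmj)
  have hl (n : ℤ) (h1 : m' ≤ n) (h2 : n ≤ i) :
      T.dist u (γ n) + T.dist (γ n) (g ^ k • z) = T.dist u (g ^ k • z) := by
    have := hT.dist_add_dist_of_isProj (m := -n) hline.neg hui.neg hz'.neg (by omega) (by omega)
      (by omega)
    simpa using this
  have hmem (n : ℤ) (hn : ¬ T.Avoids γ (powFixed V g) n) (hne : n ≠ i) : γ n ∈ powFixed V g := by
    simp only [SimpleGraph.Avoids, not_forall, not_not] at hn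
    obtain ⟨t, ht, htn⟩ := hn
    refine mem_powFixed_of_between hT hiso huF ht ?_
    have h1 := hT.dist_eq_of_isProj_ne hline hui htn hne.symm
    have h2 := hui n
    have h3 := T.dist_comm (u := t) (v := γ n)
    omega
  have heq : m - i = i - m' := by
    rcases lt_trichotomy (m - i) (i - m') with hlt' | heq | hgt'
    · exfalso
      refine hm (γ m) ?_ (hline.isProj m)
      have hC := hl (m' + 1) (by omega) (by omega)
      refine mem_powFixed_of_dist_le (z := g ^ k • z) (k := -k) hT hiso hu
        (hmem _ (hgt (m' + 1) (by omega) (by omega)) (by omega)) hC ?_ ?_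
      · simpa using hr m (by omega) (by omega)
      · have h1 := hui m
        have h2 := hui (m' + 1)
        omega
    · exact heq
    · exfalso
      refine hm' (γ m') ?_ (hline.isProj m')
      have hC := hr (m - 1) (by omega) (by omega)
      refine mem_powFixed_of_dist_le (z := z) (k := k) hT hiso hu
        (hmem _ (hlt (m - 1) (by omega) (by omega)) (by omega)) hC
        (hl m' (by omega) (by omega)) ?_
      have h1 := hui m'
      have h2 := hui (m - 1)
      omega
  have hmove (n : ℤ) (h1 : i ≤ n) (h2 : n ≤ m) : g ^ k • γ n = γ (2 * i - n) := by
    have h3 := hr n h1 h2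
    have h4 := hl (2 * i - n) (by omega) (by omega)
    rw [← hiso (g ^ k), ← hiso (g ^ k) (γ n), ← hiso (g ^ k) u z, hgu] at h3
    refine hT.eq_of_dist_eq_of_between h3 h4 ?_
    have h5 := hiso (g ^ k) u (γ n)
    rw [hgu] at h5
    have h6 := hui n
    have h7 := hui (2 * i - n)
    omega
  have hwidth : (m - 1 - (m' + 1)).natAbs < ℓ := by
    have h1 := hlt (m - 1) (by omega) (by omega)
    have h2 := hgt (m' + 1) (by omega) (by omega)
    simp only [SimpleGraph.Avoids, not_forall, not_not] at h1 h2
    obtain ⟨s, hs, hs'⟩ := h1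
    obtain ⟨t, ht, ht'⟩ := h2
    exact hF s hs t ht _ _ hs' ht'
  have hdisp (n : ℤ) (h1 : i ≤ n) (h2 : n ≤ m) : (h * g ^ k) • γ n = γ (2 * i - n + ℓ) := by
    rw [mul_smul, hmove n h1 h2, hγ.smul]
  have h1 := hmin k (γ m)
  rw [hdisp m (by omega) le_rfl, hline] at h1
  have hadj := hline.adj (m - 1)
  rw [sub_add_cancel] at hadj
  refine hninv (h * g ^ k) _ _ hadj ⟨?_, ?_⟩
  · rw [hdisp _ (by omega) (by omega)]
    congr 1; omega
  · rw [hdisp _ (by omega) (by omega)]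
    congr 1; omega

/-- If `g` has a fixed vertex, `h` translates along an axis, and the projection to this axis of
the vertices fixed by powers of `g` is shorter than the translation length of `h`, which is minimal,
then `g` and `h` generate a free group. -/
lemma isFreeGroup_of_powFixed (hT : T.IsTree)
    (hiso : ∀ (g : G) (u v : V), T.dist (g • u) (g • v) = T.dist u v)
    (hninv : ∀ (g : G) (u v : V), T.Adj u v → ¬(g • u = v ∧ g • v = u))
    (hgen : Subgroup.closure {g, h} = ⊤)
    (hγ : IsAxis T h ℓ γ) (hu : g • u = u) (hmin : ∀ (k : ℤ) v, ℓ ≤ T.dist v ((h * g ^ k) • v))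
    (hF : ∀ s ∈ powFixed V g, ∀ t ∈ powFixed V g, ∀ i j, T.IsProj γ s i → T.IsProj γ t j →
      (i - j).natAbs < ℓ) : IsFreeGroup G := by
  have huF := mem_powFixed_of_smul_eq hu
  obtain ⟨i, hi⟩ := hT.exists_isProj hγ.isLine u
  refine isFreeGroup_of_ping_pong (closure_pair_swap hgen)
    {z | ∀ j, T.IsProj γ z j → T.Avoids γ (powFixed V g) j}
    {z | ∀ j, T.IsProj γ z j → T.Avoids γ (powFixed V g) j}ᶜ ?_ ?_ disjoint_compl_right ?_ ?_
  · refine ⟨γ (i + ℓ), fun j hj t ht htj ↦ ?_⟩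
    obtain rfl := hj.unique (hγ.isLine.isProj _)
    have := hF u huF t ht _ _ hi htj
    omega
  · exact ⟨u, fun hu' ↦ hu' i hi u huF hi⟩
  · intro k hk z hz j' hj' t ht htj
    obtain ⟨j, hj⟩ := hT.exists_isProj hγ.isLine z
    refine hz fun j₁ hj₁ s hs hsj ↦ ?_
    obtain rfl := hj'.unique (hγ.isProj_zpow_smul hiso hj₁ k)
    have := hF s hs t ht _ _ hsj htj
    have := Int.natAbs_sub_add_mul_ge j₁ k hk ℓ
    omega
  · intro k hk z hz hz'
    obtain ⟨j, hj⟩ := hT.exists_isProj hγ.isLine z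
    obtain ⟨j', hj'⟩ := hT.exists_isProj hγ.isLine (g ^ k • z)
    have hjav := hz j hj
    have hjav' := hz' j' hj'
    have hij : i ≠ j := by rintro rfl; exact hjav u huF hi
    have hij' : i ≠ j' := by rintro rfl; exact hjav' u huF hi
    rcases hij.lt_or_gt with h1 | h1 <;> rcases hij'.lt_or_gt with h2 | h2
    · exact not_avoids_of_lt_of_lt hT hiso hγ.isLine hu hi hk hj hj' h1 h2 hjav hjav'
    · exact not_avoids_of_lt_of_gt hT hiso hninv hγ hu hmin hF hi hj hj' h1 h2 hjav hjav'
    · exact not_avoids_of_lt_of_gt (k := -k) hT hiso hninv hγ hu hmin hF hi hj'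
        (by simpa using hj) h2 h1 hjav' hjav
    · exact not_avoids_of_lt_of_lt hT hiso hγ.isLine.neg hu hi.neg hk hj.neg hj'.neg (by omega)
        (by omega) hjav.neg hjav'.neg

end Elliptic

/-- On a tree every `ZMod 2`-valued edge labelling is the coboundary of a vertex labelling. -/
lemma SimpleGraph.IsTree.exists_potential {V : Type*} {T : SimpleGraph V} (hT : T.IsTree)
    (c : V → V → ZMod 2) (hc : ∀ u w, c u w = c w u) :
    ∃ f : V → ZMod 2, ∀ u w, T.Adj u w → f u + f w = c u w := by
  obtain ⟨r⟩ := hT.connected.nonempty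
  have hpar (v : V) : ∃ w, v ≠ r → T.Adj v w ∧ T.dist w r + 1 = T.dist v r := by
    by_cases hv : v = r
    · exact ⟨v, fun h ↦ absurd hv h⟩
    · obtain ⟨w, hw⟩ := hT.exists_adj_dist_add_one_eq hv
      exact ⟨w, fun _ ↦ hw⟩
  choose par hpar using hpar
  let F : ℕ → V → ZMod 2 := fun n ↦ Nat.rec (fun _ ↦ 0) (fun _ φ v ↦ φ (par v) + c (par v) v) n
  have key (u w : V) (huw : T.Adj u w) (hd : T.dist r w = T.dist r u + 1) :
      F (T.dist r u) u + F (T.dist r w) w = c u w := by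
    have hne : w ≠ r := by rintro rfl; simp at hd
    obtain ⟨h1, h2⟩ := hpar w hne
    rw [T.dist_comm, T.dist_comm (u := w)] at h2
    obtain rfl := hT.eq_of_adj_of_dist_eq_add_one huw h1.symm hd h2.symm
    rw [hd]
    change F (T.dist r (par w)) (par w) + (F (T.dist r (par w)) (par w) + c (par w) w) = _
    rw [← add_assoc, CharTwo.add_self_eq_zero, zero_add]
  refine ⟨fun v ↦ F (T.dist r v) v, fun u w huw ↦ ?_⟩
  rcases hT.dist_eq_dist_add_one_of_adj r huw with h | h
  · rw [add_comm, hc]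
    exact key w u huw.symm h
  · exact key u w huw h

section Orbits

variable {G V : Type*} [Group G] [MulAction G V]

lemma SameVertexOrbit.symm {u v : V} (h : SameVertexOrbit G u v) : SameVertexOrbit G v u := by
  obtain ⟨g, rfl⟩ := h
  exact ⟨g⁻¹, inv_smul_smul g u⟩

lemma SameVertexOrbit.trans {u v w : V} (h : SameVertexOrbit G u v)
    (h' : SameVertexOrbit G v w) : SameVertexOrbit G u w := by
  obtain ⟨g, rfl⟩ := h
  obtain ⟨k, rfl⟩ := h'
  exact ⟨k * g, mul_smul k g u⟩

lemma sameEdgeOrbit_comm {u w x y : V} : SameEdgeOrbit G u w x y ↔ SameEdgeOrbit G w u x y := by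
  constructor <;> rintro ⟨g, h | h⟩
  exacts [⟨g, .inr h.symm⟩, ⟨g, .inl h.symm⟩, ⟨g, .inr h.symm⟩, ⟨g, .inl h.symm⟩]

lemma SameEdgeOrbit.of_smul {k : G} {u w x y : V} (h : SameEdgeOrbit G (k • u) (k • w) x y) :
    SameEdgeOrbit G u w x y := by
  obtain ⟨g, h⟩ := h
  exact ⟨g * k, by simpa only [mul_smul] using h⟩

lemma sameEdgeOrbit_smul_iff {k : G} {u w x y : V} :
    SameEdgeOrbit G (k • u) (k • w) x y ↔ SameEdgeOrbit G u w x y := by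
  refine ⟨.of_smul, fun h ↦ .of_smul (k := k⁻¹) ?_⟩
  simpa using h

lemma SameEdgeOrbit.refl (u w : V) : SameEdgeOrbit G u w u w := ⟨1, by simp⟩

/-- With two vertex orbits and two edge orbits there is a vertex at which both edge orbits occur,
and the corresponding neighbours are in the same orbit. -/
lemma exists_adj_adj_not_sameEdgeOrbit {T : SimpleGraph V}
    (hsimp : ∀ (g : G) (u v : V), T.Adj u v → T.Adj (g • u) (g • v))
    (hvorb : ∃ v₁ v₂ : V, ∀ v : V, SameVertexOrbit G v v₁ ∨ SameVertexOrbit G v v₂)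
    (heorb : ∃ u₁ w₁ u₂ w₂ : V, T.Adj u₁ w₁ ∧ T.Adj u₂ w₂ ∧ ¬ SameEdgeOrbit G u₁ w₁ u₂ w₂)
    (hbip : ∀ u w : V, T.Adj u w → ¬ SameVertexOrbit G u w) :
    ∃ v x y : V, T.Adj v x ∧ T.Adj v y ∧ ¬ SameEdgeOrbit G v y v x ∧ SameVertexOrbit G x y := by
  obtain ⟨v₁, v₂, hv⟩ := hvorb
  obtain ⟨u₁, w₁, u₂, w₂, h₁, h₂, hne⟩ := heorb
  have hthree (a b c : V) (hab : ¬ SameVertexOrbit G a b) (hac : ¬ SameVertexOrbit G a c) :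
      SameVertexOrbit G b c := by
    rcases hv a with ha | ha <;> rcases hv b with hb | hb <;> rcases hv c with hc | hc
    all_goals first
      | exact hb.trans hc.symm
      | exact absurd (ha.trans hb.symm) hab
      | exact absurd (ha.trans hc.symm) hac
  wlog hu : SameVertexOrbit G u₁ u₂ generalizing u₁ w₁
  · refine this w₁ u₁ h₁.symm (fun h ↦ hne (sameEdgeOrbit_comm.mp h)) ?_
    exact hthree u₁ w₁ u₂ (hbip _ _ h₁) hu
  obtain ⟨g, rfl⟩ := hu
  have h₁' := hsimp g _ _ h₁
  refine ⟨g • u₁, w₂, g • w₁, h₂, h₁', fun h ↦ hne h.of_smul, ?_⟩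
  exact hthree _ _ _ (hbip _ _ h₂) (hbip _ _ h₁')

/-- The parity of the number of edges in a given orbit on paths from `z` to `g • z` defines a
proper subgroup containing all elements with a fixed vertex. -/
lemma exists_parity_subgroup {T : SimpleGraph V} (hT : T.IsTree)
    (hsimp : ∀ (g : G) (u v : V), T.Adj u v → T.Adj (g • u) (g • v))
    (hvorb : ∃ v₁ v₂ : V, ∀ v : V, SameVertexOrbit G v v₁ ∨ SameVertexOrbit G v v₂)
    (heorb : ∃ u₁ w₁ u₂ w₂ : V, T.Adj u₁ w₁ ∧ T.Adj u₂ w₂ ∧ ¬ SameEdgeOrbit G u₁ w₁ u₂ w₂)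
    (hbip : ∀ u w : V, T.Adj u w → ¬ SameVertexOrbit G u w) :
    ∃ H : Subgroup G, H ≠ ⊤ ∧ (∀ (g : G) (v : V), g • v = v → g ∈ H) ∧
      ∀ (h : G) (v x : V), T.Adj v x → T.Adj v (h • x) → SameEdgeOrbit G v x v (h • x) →
        h ∈ H := by
  classical
  obtain ⟨v, x, y, hvx, hvy, hne, k, rfl⟩ :=
    exists_adj_adj_not_sameEdgeOrbit hsimp hvorb heorb hbip
  let c : V → V → ZMod 2 := fun u w ↦ if SameEdgeOrbit G u w v x then 1 else 0
  have hc (u w : V) : c u w = c w u := by simp only [c, sameEdgeOrbit_comm]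
  have hcsmul (g : G) (u w : V) : c (g • u) (g • w) = c u w := by
    simp only [c, sameEdgeOrbit_smul_iff]
  obtain ⟨f, hf⟩ := hT.exists_potential c hc
  have hconst (g : G) (u w : V) : f (g • u) - f u = f (g • w) - f w := by
    obtain ⟨p⟩ := hT.connected.preconnected u w
    induction p with
    | nil => rfl
    | @cons a b _ hab _ ih =>
      rw [← ih]
      have h1 := hf _ _ hab
      have h2 := hf _ _ (hsimp g _ _ hab)
      rw [hcsmul, ← h1] at h2
      have htwo : (2 : ZMod 2) = 0 := rfl
      linear_combination h2 + (f b - f (g • b)) * htwo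
  let H : Subgroup G :=
    { carrier := {g | ∀ w, f (g • w) = f w}
      one_mem' := by simp
      mul_mem' := fun {a b} ha hb w ↦ by rw [mul_smul, ha, hb]
      inv_mem' := fun {a} ha w ↦ by rw [← ha (a⁻¹ • w), smul_inv_smul] }
  have hmem (g : G) (w : V) (hw : f (g • w) = f w) : g ∈ H := fun w' ↦ by
    rw [← sub_eq_zero, hconst g w' w, hw, sub_self]
  refine ⟨H, fun htop ↦ ?_, fun g w hw ↦ hmem g w (by rw [hw]), fun h v' x' h1 h2 h3 ↦ ?_⟩
  · have hk : k ∈ H := htop ▸ Subgroup.mem_top k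
    have h1 := hf _ _ hvx
    have h2 := hf _ _ hvy
    rw [hk x, h1] at h2
    simp [c, SameEdgeOrbit.refl, hne] at h2
  · refine hmem h x' ?_
    have h4 : c v' x' = c v' (h • x') := by
      obtain ⟨g, ⟨e1, e2⟩ | ⟨e1, e2⟩⟩ := h3
      · rw [← hcsmul g v' x', e1, e2]
      · rw [← hcsmul g v' x', e1, e2, hc]
    rw [← hf _ _ h1, ← hf _ _ h2] at h4
    exact (add_left_cancel h4).symm

end Orbits

/-- In a 2-acylindrical action without edges in a single vertex orbit, an element fixes the
midpoint of a path of length two whose endpoints are fixed by one of its nontrivial powers. -/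
lemma smul_eq_of_zpow_smul_eq {G V : Type*} [Group G] [MulAction G V] {T : SimpleGraph V}
    (hT : T.IsTree) (hiso : ∀ (g : G) (u v : V), T.dist (g • u) (g • v) = T.dist u v)
    (hacyl : ∀ g : G, g ≠ 1 → ∀ u v : V, g • u = u → g • v = v → T.dist u v ≤ 2)
    (hbip : ∀ u w : V, T.Adj u w → ¬ SameVertexOrbit G u w)
    {g : G} {N : ℤ} (hN : g ^ N ≠ 1) {x v y : V} (hvx : T.Adj v x) (hvy : T.Adj v y)
    (hxy : T.dist x y = 2) (hx : g ^ N • x = x) (hy : g ^ N • y = y) : g • v = v := by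
  have h1 := T.dist_eq_one_iff_adj.mpr hvx.symm
  have h2 := T.dist_eq_one_iff_adj.mpr hvy
  have hv : g ^ N • v = v := smul_eq_of_between hT hiso hx hy (by omega)
  have hgv : g ^ N • g • v = g • v := by
    rw [← mul_smul, ← zpow_add_one, add_comm, zpow_one_add, mul_smul, hv]
  have h3 := hacyl _ hN _ _ hgv hx
  have h4 := hacyl _ hN _ _ hgv hy
  have h5 := hacyl _ hN _ _ hgv hv
  have h6 : T.dist (g • v) v ≠ 1 := fun h ↦
    hbip v (g • v) (T.dist_eq_one_iff_adj.mp h).symm ⟨g, rfl⟩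
  by_contra hne
  have h7 := hT.connected.pos_dist_of_ne hne
  have h8 := hT.dist_eq_dist_add_one_of_adj (g • v) hvx
  have h9 := hT.dist_eq_dist_add_one_of_adj (g • v) hvy
  have hc := T.dist_comm (u := g • v) (v := x)
  exact hne (hT.eq_of_dist_eq_of_between (a := x) (b := y) (by omega) (by omega) (by omega))

lemma pow_natAbs_smul_eq {G V : Type*} [Group G] [MulAction G V] {g : G} {k : ℤ} {x : V}
    (hx : g ^ k • x = x) : g ^ k.natAbs • x = x := by
  have := zpow_mul_smul_eq hx k.sign
  rwa [Int.mul_sign_self, zpow_natCast] at this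

/-- **Two-vertex 2-acylindrical splittings.**  Let `G` be a torsion-free, non-free, 2-generated
group acting simplicially, without inversions and 2-acylindrically on a simplicial tree `T` with
at least one edge, with exactly two orbits of vertices, exactly two orbits of unordered edges,
and the endpoints of every edge in different vertex orbits.  Then there is a generating pair
`(g, h)`, a vertex `v`, neighbours `x`, `y` of `v` with `{v,x}` and `{v,y}` in different edge
orbits, and `n, m ≥ 1` with `g ^ n ≠ 1 ≠ g ^ m`, such that `g` fixes `v`, `g ^ n` fixes `x`,
`g ^ m` fixes `y`, and `h` maps `x` to `y` or `y` to `x`. -/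
theorem generating_pair_of_two_vertex_two_edge_orbit_action
    {G V : Type*} [Group G] (T : SimpleGraph V) (hT : T.IsTree)
    [MulAction G V]
    (hsimp : ∀ (g : G) (u v : V), T.Adj u v → T.Adj (g • u) (g • v))
    (hninv : ∀ (g : G) (u v : V), T.Adj u v → ¬(g • u = v ∧ g • v = u))
    (hacyl : ∀ g : G, g ≠ 1 → ∀ u v : V, g • u = u → g • v = v → T.dist u v ≤ 2)
    (hedge : ∃ u w : V, T.Adj u w)
    (hvorb : ∃ v₁ v₂ : V, ¬ SameVertexOrbit G v₁ v₂ ∧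
      ∀ v : V, SameVertexOrbit G v v₁ ∨ SameVertexOrbit G v v₂)
    (heorb : ∃ u₁ w₁ u₂ w₂ : V, T.Adj u₁ w₁ ∧ T.Adj u₂ w₂ ∧
      ¬ SameEdgeOrbit G u₁ w₁ u₂ w₂ ∧
      ∀ u w : V, T.Adj u w → SameEdgeOrbit G u w u₁ w₁ ∨ SameEdgeOrbit G u w u₂ w₂)
    (hbip : ∀ u w : V, T.Adj u w → ¬ SameVertexOrbit G u w)
    (htf : ∀ (g : G) (n : ℕ), 1 ≤ n → g ^ n = 1 → g = 1)
    (hnonfree : ¬ IsFreeGroup G)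
    (h2gen : ∃ a b : G, Subgroup.closure {a, b} = ⊤) :
    ∃ (g h : G) (v x y : V) (n m : ℕ),
      Subgroup.closure {g, h} = ⊤ ∧
      T.Adj v x ∧ T.Adj v y ∧ ¬ SameEdgeOrbit G v x v y ∧
      1 ≤ n ∧ 1 ≤ m ∧ g ^ n ≠ 1 ∧ g ^ m ≠ 1 ∧
      g • v = v ∧ g ^ n • x = x ∧ g ^ m • y = y ∧
      (h • x = y ∨ h • y = x) := by
  have hiso := dist_smul_smul_of_adj hT.connected hsimp
  obtain ⟨H, hHtop, hHfix, hHedge⟩ := exists_parity_subgroup hT hsimp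
    (by obtain ⟨v₁, v₂, -, hv⟩ := hvorb; exact ⟨v₁, v₂, hv⟩)
    (by obtain ⟨u₁, w₁, u₂, w₂, h₁, h₂, hne, -⟩ := heorb; exact ⟨u₁, w₁, u₂, w₂, h₁, h₂, hne⟩)
    hbip
  obtain ⟨a, b, hab, w, haw⟩ : ∃ a b : G, Subgroup.closure {a, b} = ⊤ ∧ ∃ v : V, a • v = v := by
    by_contra! hne
    exact hnonfree (isFreeGroup_of_forall_smul_ne hT hsimp hninv h2gen hne)
  let S := {x : (G × G) × V // Subgroup.closure {x.1.1, x.1.2} = ⊤ ∧ ∃ v : V, x.1.1 • v = v}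
  have : Nonempty S := ⟨⟨((a, b), w), hab, w, haw⟩⟩
  let F : S → ℕ := fun x ↦ T.dist x.1.2 (x.1.1.2 • x.1.2)
  obtain ⟨⟨⟨⟨g, h⟩, p⟩, hgen, u, hu⟩, hmin⟩ : ∃ x : S, ∀ y, F x ≤ F y :=
    ⟨_, fun y ↦ Function.argmin_le F y⟩
  dsimp only at hgen hu
  have hmin' (k : ℤ) (q : V) : T.dist p (h • p) ≤ T.dist q ((h * g ^ k) • q) := by
    refine hmin ⟨((g, h * g ^ k), q), ?_, u, hu⟩
    have hA : g ∈ Subgroup.closure {g, h * g ^ k} := Subgroup.subset_closure (by simp)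
    have hB : h * g ^ k ∈ Subgroup.closure {g, h * g ^ k} := Subgroup.subset_closure (by simp)
    refine closure_pair_eq_top hgen hA ?_
    simpa using mul_mem hB (inv_mem (zpow_mem hA k))
  have hhH : h ∉ H := fun hh ↦ hHtop <| top_le_iff.mp <| hgen ▸ (Subgroup.closure_le H).mpr
    (Set.pair_subset (hHfix g u hu) hh)
  have hℓ := hT.connected.pos_dist_of_ne fun hp : p = h • p ↦ hhH (hHfix h p hp.symm)
  obtain ⟨γ, hγ⟩ := exists_isAxis hT hsimp (hninv h) hℓ rfl fun v ↦ by simpa using hmin' 0 v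
  set ℓ := T.dist p (h • p)
  have hg : g ≠ 1 := by
    rintro rfl
    exact hnonfree (isFreeGroup_of_closure_one_pair htf (by rintro rfl; exact hhH H.one_mem) hgen)
  have hpow (n : ℕ) (hn : 1 ≤ n) : g ^ n ≠ 1 := fun h1 ↦ hg (htf g n hn h1)
  obtain ⟨s, ⟨k, hk, hks⟩, t, ⟨l, hl, hlt⟩, i, j, hsi, htj, hij, hle⟩ : ∃ s ∈ powFixed V g,
      ∃ t ∈ powFixed V g, ∃ i j, T.IsProj γ s i ∧ T.IsProj γ t j ∧ i < j ∧ ℓ ≤ j - i := by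
    by_contra! hF
    refine hnonfree (isFreeGroup_of_powFixed hT hiso hninv hgen hγ hu hmin'
      fun s hs t ht i j hsi htj ↦ ?_)
    rcases lt_trichotomy i j with hij | rfl | hij
    · have := hF s hs t ht i j hsi htj hij
      omega
    · simpa using hℓ
    · have := hF t ht s hs j i htj hsi hij
      omega
  have hNs := zpow_mul_smul_eq hks l
  have hNt := zpow_mul_smul_eq hlt k
  rw [mul_comm] at hNt
  have hN : g ^ (k * l) ≠ 1 := fun h1 ↦ hpow (k * l).natAbs (by
    have := Int.natAbs_pos.mpr (mul_ne_zero hk hl)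
    omega) (pow_natAbs_eq_one.mpr h1)
  have hst := hacyl _ hN _ _ hNs hNt
  rw [hT.dist_eq_of_isProj_ne hγ.isLine hsi htj hij.ne] at hst
  have hℓ1 : ℓ ≠ 1 := fun h1 ↦ hbip _ _ (hγ.isLine.adj i) ⟨h, by rw [hγ.smul, h1]; rfl⟩
  obtain rfl := hT.dist_eq_zero (show T.dist s (γ i) = 0 by omega)
  obtain rfl := hT.dist_eq_zero (show T.dist t (γ j) = 0 by omega)
  obtain rfl : j = i + 1 + 1 := by omega
  have hh : h • γ i = γ (i + 1 + 1) := by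
    rw [hγ.smul]
    congr 1; omega
  have hvx := (hγ.isLine.adj i).symm
  have hvy := hγ.isLine.adj (i + 1)
  have hgv := smul_eq_of_zpow_smul_eq hT hiso hacyl hbip hN hvx hvy (by rw [hγ.isLine]; omega)
    hNs hNt
  refine ⟨g, h, γ (i + 1), γ i, γ (i + 1 + 1), k.natAbs, l.natAbs, hgen, hvx, hvy, fun he ↦ ?_,
    Int.natAbs_pos.mpr hk, Int.natAbs_pos.mpr hl, hpow _ (Int.natAbs_pos.mpr hk),
    hpow _ (Int.natAbs_pos.mpr hl), hgv, pow_natAbs_smul_eq hks, pow_natAbs_smul_eq hlt, .inl hh⟩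
  rw [← hh] at he hvy
  exact hhH (hHedge h _ _ hvx hvy he)
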